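/- Let R be a commutative noetherian ring, let A and B be commutative Hopf algebras over R that are flat as R-modules, and let φ : A → B be a homomorphism of R-bialgebras (equivalently, of Hopf algebras). Then the following are equivalent: (1) B is faithfully flat as an A-module via φ; (2) for every prime ideal p of R, B ⊗_R k(p) is faithfully flat as an (A ⊗_R k(p))-module via φ ⊗_R k(p); (3) φ is a pure map of R-modules. -/

import Mathlib

open TensorProduct

universe u

theorem MultilinearMap.apply_mem_of_forall_mem_span {ι R M N : Type*} [CommRing R]
    [AddCommGroup M] [Module R M] [AddCommGroup N] [Module R N] [Fintype ι] [DecidableEq ι]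
    (g : MultilinearMap R (fun _ : ι => M) N) (S : Set M) (P : Submodule R N)
    (h : ∀ x, (∀ i, x i ∈ S) → g x ∈ P) (x : ι → M)
    (hx : ∀ i, x i ∈ Submodule.span R S) : g x ∈ P := by
  have key : ∀ t : Finset ι, ∀ x : ι → M, (∀ i ∈ t, x i ∈ Submodule.span R S) →
      (∀ i ∉ t, x i ∈ S) → g x ∈ P := by
    intro t
    induction t using Finset.induction_on with
    | empty => exact fun x _ h' => h x fun i => h' i (by simp)
    | insert i t hi ih =>
      intro x hx hx'
      have step : ∀ m ∈ Submodule.span R S, g (Function.update x i m) ∈ P := by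
        intro m hm
        induction hm using Submodule.span_induction with
        | mem m hm =>
          refine ih _ (fun j hj => ?_) (fun j hj => ?_)
          · have : j ≠ i := fun e => hi (e ▸ hj)
            simpa [this] using hx j (Finset.mem_insert_of_mem hj)
          · by_cases e : j = i
            · subst e; simpa using hm
            · simpa [e] using hx' j (by simp [e, hj])
        | zero => simp
        | add a b _ _ ha hb => rw [g.map_update_add]; exact P.add_mem ha hb
        | smul c a _ ha => rw [g.map_update_smul]; exact P.smul_mem c ha
      simpa using step (x i) (hx i (Finset.mem_insert_self i t))
  exact key Finset.univ x (fun i _ => hx i) (fun i hi => absurd (Finset.mem_univ i) hi)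

/-- The ideal generated by the minors of size `s` of matrices whose rows lie in `K`. -/
def minorIdeal {A : Type*} [CommRing A] {n : ℕ} (K : Set (Fin n → A)) (s : ℕ) : Ideal A :=
  Ideal.span {d | ∃ (f : Fin s → Fin n) (x : Fin s → Fin n → A), (∀ j, x j ∈ K) ∧
    d = (Matrix.of fun j i => x j (f i)).det}

theorem minorIdeal_zero {A : Type*} [CommRing A] {n : ℕ} (K : Set (Fin n → A)) :
    minorIdeal K 0 = ⊤ :=
  (Ideal.eq_top_iff_one _).2 <| Ideal.subset_span ⟨Fin.elim0, Fin.elim0, fun j => j.elim0, by simp⟩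

theorem minorIdeal_succ_self {A : Type*} [CommRing A] {n : ℕ} (K : Set (Fin n → A)) :
    minorIdeal K (n + 1) = ⊥ := by
  refine Ideal.span_eq_bot.2 ?_
  rintro _ ⟨f, x, -, rfl⟩
  obtain ⟨i, j, hij, hf⟩ := Fintype.exists_ne_map_eq_of_card_lt f (by simp)
  exact Matrix.det_zero_of_column_eq hij (fun k => by simp [hf])

theorem det_mem_map_minorIdeal {A C : Type*} [CommRing A] [CommRing C] (ι : A →+* C) {n : ℕ}
    (K : Set (Fin n → A)) (s : ℕ) (f y : Fin s → Fin n → C)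
    (hy : ∀ j, y j ∈ Submodule.span C ((fun x i => ι (x i)) '' K)) :
    (Matrix.of fun j i => ∑ l, f i l * y j l).det ∈ (minorIdeal K s).map ι := by
  have h1 : ∀ (g : Fin s → Fin n) (y : Fin s → Fin n → C),
      (∀ j, y j ∈ Submodule.span C ((fun x i => ι (x i)) '' K)) →
      (Matrix.of fun j i => y j (g i)).det ∈ (minorIdeal K s).map ι := by
    intro g y hy
    let L : (Fin n → C) →ₗ[C] (Fin s → C) := LinearMap.funLeft C C g
    refine MultilinearMap.apply_mem_of_forall_mem_span
      (((Matrix.detRowAlternating (n := Fin s) (R := C)).toMultilinearMap).compLinearMap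
        fun _ => L) _ ((minorIdeal K s).map ι) ?_ y hy
    intro x hx
    choose z hz hzx using hx
    have : (((Matrix.detRowAlternating (n := Fin s) (R := C)).toMultilinearMap).compLinearMap
        fun _ => L) x = ι (Matrix.of fun j i => z j (g i)).det := by
      rw [RingHom.map_det]
      change Matrix.det _ = _
      congr 1
      ext i j
      simp [L, ← hzx, LinearMap.funLeft]
    rw [this]
    exact Ideal.mem_map_of_mem _ (Ideal.subset_span ⟨g, z, hz, rfl⟩)
  let L (j : Fin s) : (Fin n → C) →ₗ[C] C :=
    { toFun := fun c => ∑ l, c l * y j l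
      map_add' := fun a b => by simp [add_mul, Finset.sum_add_distrib]
      map_smul' := fun a b => by simp [Finset.mul_sum, mul_assoc] }
  rw [← Matrix.det_transpose]
  refine MultilinearMap.apply_mem_of_forall_mem_span
      (((Matrix.detRowAlternating (n := Fin s) (R := C)).toMultilinearMap).compLinearMap
        fun _ => LinearMap.pi L) (Set.range fun i : Fin n => Pi.single i (1 : C))
        ((minorIdeal K s).map ι) ?_ f ?_
  · intro x hx
    choose g hg using hx
    have : (((Matrix.detRowAlternating (n := Fin s) (R := C)).toMultilinearMap).compLinearMap
        fun _ => LinearMap.pi L) x = (Matrix.of fun j i => y j (g i)).det := by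
      rw [← Matrix.det_transpose]
      change Matrix.det _ = _
      congr 1
      ext i j
      simp [L, ← hg, Pi.single_apply]
    rw [this]
    exact h1 g y hy
  · intro i
    have : f i = ∑ l, f i l • (Pi.single l (1 : C) : Fin n → C) := by
      ext j; simp [Finset.sum_apply, Pi.single_apply]
    rw [this]
    exact Submodule.sum_mem _ fun l _ => Submodule.smul_mem _ _ (Submodule.subset_span ⟨l, rfl⟩)

theorem exists_retraction_of_minorIdeal {A : Type*} [CommRing A] {n : ℕ}
    (K : Submodule A (Fin n → A)) (s : ℕ) (h1 : minorIdeal (K : Set (Fin n → A)) s = ⊤)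
    (h2 : minorIdeal (K : Set (Fin n → A)) (s + 1) = ⊥) :
    ∃ r : (Fin n → A) →ₗ[A] (Fin n → A), (∀ x, r x ∈ K) ∧ ∀ x ∈ K, r x = x := by
  let J : Ideal A :=
    { carrier := {a | ∃ r : (Fin n → A) →ₗ[A] (Fin n → A), (∀ x, r x ∈ K) ∧ ∀ x ∈ K, r x = a • x}
      add_mem' := by
        rintro a b ⟨r, hr, hr'⟩ ⟨t, ht, ht'⟩
        exact ⟨r + t, fun x => K.add_mem (hr x) (ht x),
          fun x hx => by simp [hr' x hx, ht' x hx, add_smul]⟩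
      zero_mem' := ⟨0, fun x => by simp, fun x _ => by simp⟩
      smul_mem' := by
        rintro c a ⟨r, hr, hr'⟩
        exact ⟨c • r, fun x => K.smul_mem _ (hr x), fun x hx => by simp [hr' x hx, mul_smul]⟩ }
  suffices h : (1 : A) ∈ J by
    obtain ⟨r, hr, hr'⟩ := h
    exact ⟨r, hr, fun x hx => by simpa using hr' x hx⟩
  rw [← Ideal.eq_top_iff_one, eq_top_iff, ← Ideal.span_pow_eq_top _ h1 2, Ideal.span_le]
  rintro _ ⟨_, ⟨f, x, hx, rfl⟩, rfl⟩
  set F : Matrix (Fin s) (Fin s) A := Matrix.of fun i j => x j (f i) with hF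
  have hD : (Matrix.of fun j i => x j (f i)).det = F.det := by
    rw [← Matrix.det_transpose]; rfl
  rw [hD]
  let p : (Fin n → A) →ₗ[A] (Fin n → A) :=
    (Fintype.linearCombination A x) ∘ₗ F.cramer ∘ₗ LinearMap.funLeft A A f
  have hp : ∀ y, p y = ∑ j, F.cramer (fun i => y (f i)) j • x j := fun y => rfl
  have hpK : ∀ y, p y ∈ K := fun y => by
    rw [hp]; exact K.sum_mem fun j _ => K.smul_mem _ (hx j)
  refine ⟨F.det • p, fun y => K.smul_mem _ (hpK y), fun y hy => ?_⟩
  set z := F.det • y - p y with hz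
  have hzK : z ∈ K := K.sub_mem (K.smul_mem _ hy) (hpK y)
  have hzf : ∀ i, z (f i) = 0 := by
    intro i
    have := congrFun (Matrix.mulVec_cramer F (fun i => y (f i))) i
    simp only [Matrix.mulVec, dotProduct, Pi.smul_apply, smul_eq_mul] at this
    rw [hz, hp]
    simp only [Pi.sub_apply, Pi.smul_apply, smul_eq_mul, Finset.sum_apply]
    rw [← this, sub_eq_zero]
    exact Finset.sum_congr rfl fun j _ => by simp [hF, mul_comm]
  have hDz : F.det • z = 0 := by
    ext l
    have hmem : (Matrix.of fun j i => (Fin.cons z x : Fin (s + 1) → Fin n → A) j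
        ((Fin.cons l f : Fin (s + 1) → Fin n) i)).det ∈ minorIdeal (K : Set (Fin n → A)) (s + 1) :=
      Ideal.subset_span ⟨_, _, fun j => by refine Fin.cases ?_ (fun j => ?_) j <;> simp [hzK, hx],
        rfl⟩
    rw [h2, Ideal.mem_bot, Matrix.det_succ_row_zero, Fin.sum_univ_succ] at hmem
    simp only [Matrix.of_apply, Fin.cons_zero, Fin.cons_succ, hzf] at hmem
    simp only [Fin.val_zero, pow_zero, one_mul, mul_zero, zero_mul, Finset.sum_const_zero,
      add_zero] at hmem
    rw [← hD]
    simp only [Pi.smul_apply, smul_eq_mul, Pi.zero_apply]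
    rw [mul_comm]
    convert hmem
    ext j i
    simp
  rw [hz, smul_sub, sub_eq_zero, smul_smul] at hDz
  rw [LinearMap.smul_apply, ← hDz, ← pow_two]

theorem flat_range_of_minorIdeal {A M : Type*} [CommRing A] [Nontrivial A]
    [AddCommGroup M] [Module A M] {n : ℕ}
    (u : (Fin n → A) →ₗ[A] M)
    (h : ∀ s, minorIdeal (u.ker : Set (Fin n → A)) s = ⊥ ∨
      minorIdeal (u.ker : Set (Fin n → A)) s = ⊤) :
    Module.Flat A u.range := by
  classical
  have hex : ∃ s, minorIdeal (u.ker : Set (Fin n → A)) s = ⊥ := ⟨_, minorIdeal_succ_self _⟩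
  obtain ⟨s, hs⟩ : ∃ s, Nat.find hex = s + 1 := Nat.exists_eq_succ_of_ne_zero fun h0 => by
    have := Nat.find_spec hex
    rw [h0, minorIdeal_zero] at this
    exact top_ne_bot this
  obtain ⟨r, hr, hr'⟩ := exists_retraction_of_minorIdeal u.ker s
    ((h s).resolve_left (Nat.find_min hex (by omega))) (hs ▸ Nat.find_spec hex)
  have : Module.Flat A ((Fin n → A) ⧸ u.ker) :=
    Module.Flat.of_retract (u.ker.liftQ (LinearMap.id - r) fun x hx => by
      simp [hr' x hx]) u.ker.mkQ (by
      refine LinearMap.ext fun y => ?_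
      obtain ⟨x, rfl⟩ := u.ker.mkQ_surjective y
      refine (Submodule.Quotient.eq _).2 ?_
      simpa using LinearMap.mem_ker.1 (hr x))
  exact Module.Flat.of_linearEquiv u.quotKerEquivRange.symm

open Coalgebra in
theorem exists_fg_submodule_comul_mem {k C : Type*} [Field k] [AddCommGroup C] [Module k C]
    [Coalgebra k C] (x : C) :
    ∃ V : Submodule k C, V.FG ∧ x ∈ V ∧
      V ≤ (V.subtype.rTensor C).range.comap (comul (R := k)) := by
  classical
  let 𝒴 := Module.Basis.ofVectorSpace k C
  let m := TensorProduct.equivFinsuppOfBasisRight (M := C) 𝒴 (comul x)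
  have hm : comul x = m.sum fun i c => c ⊗ₜ[k] 𝒴 i := by
    have := TensorProduct.equivFinsuppOfBasisRight_symm_apply (M := C) 𝒴 m
    rw [← this]; simp [m]
  refine ⟨Submodule.span k (m '' m.support), Submodule.fg_span (m.support.finite_toSet.image _),
    ?_, ?_⟩
  · have h := Coalgebra.lTensor_counit_comul (R := k) x
    rw [hm, Finsupp.sum] at h
    have h2 := congrArg (TensorProduct.rid k C) h
    simp only [map_sum, LinearMap.lTensor_tmul, TensorProduct.rid_tmul, one_smul] at h2
    rw [← h2]
    exact Submodule.sum_mem _ fun i hi => Submodule.smul_mem _ _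
      (Submodule.subset_span ⟨i, hi, rfl⟩)
  · rw [Submodule.span_le]
    rintro _ ⟨i, hi, rfl⟩
    have hT : ∀ z : C ⊗[k] C, comul (TensorProduct.rid k C ((𝒴.coord i).lTensor C z)) =
        ((TensorProduct.rid k C).toLinearMap ∘ₗ (𝒴.coord i).lTensor C).lTensor C
          (TensorProduct.assoc k C C C (comul.rTensor C z)) := by
      intro z
      induction z with
      | zero => simp
      | add a b ha hb => simp only [map_add, ha, hb]
      | tmul a b =>
        simp only [LinearMap.lTensor_tmul, TensorProduct.rid_tmul, map_smul,
          LinearMap.rTensor_tmul]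
        induction comul (R := k) a with
        | zero => simp
        | add c d hc hd => simp only [smul_add, TensorProduct.add_tmul, map_add, hc, hd]
        | tmul c d => simp
    have hmi : m i = TensorProduct.rid k C ((𝒴.coord i).lTensor C (comul x)) :=
      TensorProduct.equivFinsuppOfBasisRight_apply ..
    change comul (R := k) (m i) ∈ ((Submodule.span k (m '' m.support)).subtype.rTensor C).range
    rw [hmi, hT, Coalgebra.coassoc_apply, hm, Finsupp.sum]
    simp only [map_sum, LinearMap.lTensor_tmul]
    exact Submodule.sum_mem _ fun j hj => ⟨⟨m j, Submodule.subset_span ⟨j, hj, rfl⟩⟩ ⊗ₜ _, rfl⟩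

open Coalgebra in
theorem exists_fg_submodule_forall_comul_mem {k C : Type*} [Field k] [AddCommGroup C] [Module k C]
    [Coalgebra k C] {l : ℕ} (x : Fin l → C) :
    ∃ V : Submodule k C, V.FG ∧ (∀ i, x i ∈ V) ∧
      V ≤ (V.subtype.rTensor C).range.comap (comul (R := k)) := by
  choose V hV hx hc using fun i => exists_fg_submodule_comul_mem (k := k) (x i)
  refine ⟨⨆ i, V i, Submodule.fg_iSup _ hV, fun i => Submodule.mem_iSup_of_mem i (hx i),
    iSup_le fun i => (hc i).trans (Submodule.comap_mono ?_)⟩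
  have : (V i).subtype = (⨆ i, V i).subtype ∘ₗ Submodule.inclusion (le_iSup V i) := rfl
  rw [this, LinearMap.rTensor_comp]
  exact LinearMap.range_comp_le_range _ _

open Coalgebra in
theorem exists_coefficient_matrix {k B : Type*} [Field k] [CommRing B] [HopfAlgebra k B]
    {l : ℕ} (x : Fin l → B) :
    ∃ (n : ℕ) (v : Fin n → B) (b : Matrix (Fin n) (Fin n) B),
      (∀ i, x i ∈ Submodule.span k (Set.range v)) ∧
      (∀ j, comul (R := k) (v j) = ∑ i, v i ⊗ₜ b i j) ∧
      ∃ c : Matrix (Fin n) (Fin n) B, c * b = 1 := by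
  classical
  obtain ⟨V, hV, hx, hc⟩ := exists_fg_submodule_forall_comul_mem (k := k) x
  have : Module.Finite k V := Module.Finite.iff_fg.2 hV
  let 𝒱 := Module.finBasis k V
  obtain ⟨p, hp⟩ := V.subtype.exists_leftInverse_of_injective (by simp)
  let f (i) : B →ₗ[k] k := 𝒱.coord i ∘ₗ p
  have hf : ∀ i j, f i (𝒱 j) = if i = j then 1 else 0 := by
    intro i j
    have : p (𝒱 j) = 𝒱 j := LinearMap.congr_fun hp (𝒱 j)
    simp [f, this, Finsupp.single_apply, eq_comm]
  choose z hz using fun j => hc (𝒱 j).2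
  let b : Matrix (Fin (Module.finrank k V)) (Fin (Module.finrank k V)) B :=
    Matrix.of fun i j => TensorProduct.equivFinsuppOfBasisLeft (N := B) 𝒱 (z j) i
  have hb : ∀ j, comul (R := k) (𝒱 j : B) = ∑ i, (𝒱 i : B) ⊗ₜ b i j := by
    intro j
    rw [← hz j]
    have := TensorProduct.equivFinsuppOfBasisLeft_symm_apply (N := B) 𝒱
      (TensorProduct.equivFinsuppOfBasisLeft (N := B) 𝒱 (z j))
    rw [LinearEquiv.symm_apply_apply, Finsupp.sum_fintype _ _ (by simp)] at this
    rw [this]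
    simp [b]
  have hbΔ : ∀ i j, comul (R := k) (b i j) = ∑ m, b i m ⊗ₜ b m j := by
    intro i j
    have h := Coalgebra.coassoc_apply (R := k) (𝒱 j : B)
    rw [hb] at h
    simp only [map_sum, LinearMap.rTensor_tmul, LinearMap.lTensor_tmul, hb,
      TensorProduct.sum_tmul, TensorProduct.assoc_tmul] at h
    have h2 := congrArg (TensorProduct.lid k _ ∘ (f i).rTensor (B ⊗[k] B)) h
    simpa [hf, ite_smul] using h2.symm
  have hbε : ∀ i j, counit (R := k) (b i j) = if i = j then 1 else 0 := by
    intro i j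
    have h := Coalgebra.lTensor_counit_comul (R := k) (𝒱 j : B)
    rw [hb] at h
    have h2 := congrArg (f i ∘ TensorProduct.rid k _) h
    simpa [hf] using h2
  refine ⟨_, fun i => (𝒱 i : B), b, fun i => ?_, hb, b.map (HopfAlgebra.antipode k), ?_⟩
  · have : (x i : B) = V.subtype ⟨x i, hx i⟩ := rfl
    rw [this, ← 𝒱.sum_repr ⟨x i, hx i⟩, map_sum]
    exact Submodule.sum_mem _ fun j _ => by
      rw [map_smul]; exact Submodule.smul_mem _ _ (Submodule.subset_span ⟨j, rfl⟩)
  · ext i j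
    have h := HopfAlgebra.mul_antipode_rTensor_comul_apply (R := k) (b i j)
    rw [hbΔ, hbε] at h
    simp only [map_sum, LinearMap.rTensor_tmul, LinearMap.mul'_apply] at h
    simp only [Matrix.mul_apply, Matrix.map_apply, h, Matrix.one_apply]
    split_ifs <;> simp

/-- The coaction `A → A ⊗ B` induced by the comultiplication of `A` and the map `A → B`. -/
noncomputable def comulBaseChange (k A B : Type*) [Field k] [CommRing A] [CommRing B]
    [HopfAlgebra k A] [Algebra k B] [Algebra A B] [IsScalarTower k A B] : A →ₐ[k] A ⊗[k] B :=
  (Algebra.TensorProduct.map (AlgHom.id k A) (IsScalarTower.toAlgHom k A B)).comp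
    (Bialgebra.comulAlgHom k A)

theorem Ideal.eq_bot_or_eq_top_of_comul_mem {k A : Type*} [Field k] [CommRing A]
    [HopfAlgebra k A] (I : Ideal A)
    (h : ∀ x ∈ I, Coalgebra.comul (R := k) x ∈
      ((I.restrictScalars k).subtype.rTensor A).range) : I = ⊥ ∨ I = ⊤ := by
  by_cases hε : ∀ x ∈ I, Coalgebra.counit (R := k) x = 0
  · left
    rw [eq_bot_iff]
    intro x hx
    obtain ⟨z, hz⟩ := h x hx
    have h1 : (Coalgebra.counit (R := k)).rTensor A ((I.restrictScalars k).subtype.rTensor A z)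
        = 0 := by
      rw [← LinearMap.comp_apply, ← LinearMap.rTensor_comp]
      have : (Coalgebra.counit (R := k) (A := A)) ∘ₗ (I.restrictScalars k).subtype = 0 :=
        LinearMap.ext fun y => hε y y.2
      rw [this, LinearMap.rTensor_zero, LinearMap.zero_apply]
    rw [hz, Coalgebra.rTensor_counit_comul] at h1
    simpa using congrArg (TensorProduct.lid k A) h1
  · right
    push Not at hε
    obtain ⟨x, hx, hε⟩ := hε
    obtain ⟨z, hz⟩ := h x hx
    have h1 := HopfAlgebra.mul_antipode_lTensor_comul_apply (R := k) x
    rw [← hz] at h1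
    have h2 : ∀ z, LinearMap.mul' k A ((HopfAlgebra.antipode k).lTensor A
        ((I.restrictScalars k).subtype.rTensor A z)) ∈ I := by
      intro z
      induction z with
      | zero => simp
      | add a b ha hb => simp only [map_add]; exact I.add_mem ha hb
      | tmul a b => simpa using I.mul_mem_right _ a.2
    have h3 := h2 z
    rw [h1] at h3
    exact Ideal.eq_top_of_isUnit_mem _ h3 ((IsUnit.mk0 _ hε).map _)

theorem Ideal.eq_bot_or_eq_top_of_comulBaseChange_mem {k A B : Type*} [Field k] [CommRing A]
    [CommRing B] [HopfAlgebra k A] [Algebra k B] [Algebra A B] [IsScalarTower k A B]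
    (hinj : Function.Injective (algebraMap A B)) (I : Ideal A)
    (h : ∀ x ∈ I, comulBaseChange k A B x ∈
      I.map (Algebra.TensorProduct.includeLeft : A →ₐ[k] A ⊗[k] B).toRingHom) :
    I = ⊥ ∨ I = ⊤ := by
  refine Ideal.eq_bot_or_eq_top_of_comul_mem (k := k) I fun x hx => ?_
  have hQ : I.map (Algebra.TensorProduct.includeLeft : A →ₐ[k] A ⊗[k] B).toRingHom ≤
      RingHom.ker (Algebra.TensorProduct.map (Ideal.Quotient.mkₐ k I) (AlgHom.id k B)) := by
    rw [Ideal.map_le_iff_le_comap]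
    intro a ha
    simp [RingHom.mem_ker, Ideal.Quotient.eq_zero_iff_mem.2 ha]
  have h1 := hQ (h x hx)
  rw [RingHom.mem_ker] at h1
  let ψ : A →ₗ[k] B := (IsScalarTower.toAlgHom k A B).toLinearMap
  have hψ : Function.Injective ψ := hinj
  have h2 : ∀ w : A ⊗[k] A, Algebra.TensorProduct.map (Ideal.Quotient.mkₐ k I) (AlgHom.id k B)
      (Algebra.TensorProduct.map (AlgHom.id k A) (IsScalarTower.toAlgHom k A B) w) =
      ψ.lTensor (A ⧸ I) ((Ideal.Quotient.mkₐ k I).toLinearMap.rTensor A w) := by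
    intro w
    induction w with
    | zero => simp
    | add a b ha hb => simp only [map_add, ha, hb]
    | tmul a b => simp [ψ]
  have h3 : (Ideal.Quotient.mkₐ k I).toLinearMap.rTensor A (Coalgebra.comul (R := k) x) = 0 := by
    apply Module.Flat.lTensor_preserves_injective_linearMap (M := A ⧸ I) ψ hψ
    rw [map_zero, ← h2]
    exact h1
  have hex : Function.Exact (I.restrictScalars k).subtype
      (Ideal.Quotient.mkₐ k I).toLinearMap := by
    intro y
    simp [Ideal.Quotient.eq_zero_iff_mem]
  exact ((Module.Flat.rTensor_exact A hex) _).1 h3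

theorem Module.Flat.quotient_of_comul_mem {k A B : Type*} [Field k] [CommRing A] [CommRing B]
    [HopfAlgebra k A] [HopfAlgebra k B] [Algebra A B] [IsScalarTower k A B]
    (hinj : Function.Injective (algebraMap A B))
    (hΔ : ∀ a : A, Coalgebra.comul (R := k) (algebraMap A B a) =
      Algebra.TensorProduct.map (IsScalarTower.toAlgHom k A B) (AlgHom.id k B)
        (comulBaseChange k A B a))
    (D : Submodule A B)
    (hD : ∀ d ∈ D, (D.mkQ.restrictScalars k).rTensor B (Coalgebra.comul (R := k) d) = 0) :
    Module.Flat A (B ⧸ D) := by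
  have : Nontrivial A := Bialgebra.nontrivial k
  have hmain : ∀ {l : ℕ} (x : Fin l → B), ∃ W : Submodule A (B ⧸ D), Module.Flat A W ∧
      ∀ i, D.mkQ (x i) ∈ W := by
    intro l x
    obtain ⟨n, v, b, hx, hv, c, hcb⟩ := exists_coefficient_matrix (k := k) x
    let u₀ : (Fin n → A) →ₗ[A] B := Fintype.linearCombination A v
    let u := D.mkQ ∘ₗ u₀
    refine ⟨u.range, flat_range_of_minorIdeal u fun s => ?_, fun i => ?_⟩
    · refine Ideal.eq_bot_or_eq_top_of_comulBaseChange_mem (k := k) (B := B) hinj _ ?_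
      set ι : A →ₐ[k] A ⊗[k] B := Algebra.TensorProduct.includeLeft with hι
      let inr : B →ₐ[k] A ⊗[k] B := Algebra.TensorProduct.includeRight
      set δ := comulBaseChange k A B with hδ
      -- The twisted coaction sends relations into the span of relations.
      have hrel : ∀ a ∈ u.ker, (fun i => ∑ j, δ (a j) * inr (b i j)) ∈
          Submodule.span (A ⊗[k] B)
            ((fun x i => ι.toRingHom (x i)) '' (u.ker : Set (Fin n → A))) := by
        intro a ha
        set w : Fin n → A ⊗[k] B := fun i => ∑ j, δ (a j) * inr (b i j) with hw
        let w' : (Fin n → A) ⊗[k] B := ∑ i, (LinearMap.single k (fun _ => A) i).rTensor B (w i)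
        have hw' : (u.restrictScalars k).rTensor B w' = 0 := by
          have hu : u.restrictScalars k = D.mkQ.restrictScalars k ∘ₗ u₀.restrictScalars k := rfl
          have h1 : (u₀.restrictScalars k).rTensor B w' = Coalgebra.comul (R := k) (u₀ a) := by
            have h2 : ∀ i (z : A ⊗[k] B), (u₀.restrictScalars k).rTensor B
                ((LinearMap.single k (fun _ => A) i).rTensor B z) =
                Algebra.TensorProduct.map (IsScalarTower.toAlgHom k A B) (AlgHom.id k B) z *
                  (v i ⊗ₜ 1) := by
              intro i z
              induction z with
              | zero => simp
              | add a b ha hb => simp only [map_add, ha, hb, add_mul]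
              | tmul a b =>
                simp [u₀, Fintype.linearCombination_apply_single, Algebra.smul_def]
            have h3 : u₀ a = ∑ j, algebraMap A B (a j) * v j := by
              simp [u₀, Fintype.linearCombination_apply, Algebra.smul_def]
            simp only [w', map_sum, h2, h3, Bialgebra.comul_mul, hΔ, hv, hw, map_mul,
              Finset.mul_sum]
            rw [Finset.sum_comm]
            refine Finset.sum_congr rfl fun j _ => Finset.sum_congr rfl fun i _ => ?_
            rw [mul_assoc]
            congr 1
            simp [inr]
          rw [hu, LinearMap.rTensor_comp, LinearMap.comp_apply, h1]
          exact hD _ ((Submodule.Quotient.mk_eq_zero D).1 ha)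
        have hex : Function.Exact (u.ker.restrictScalars k).subtype (u.restrictScalars k) := by
          intro y
          simp
        obtain ⟨t, ht⟩ := ((Module.Flat.rTensor_exact B hex) _).1 hw'
        let T : (Fin n → A) ⊗[k] B →ₗ[k] (Fin n → A ⊗[k] B) :=
          LinearMap.pi fun i => (LinearMap.proj i).rTensor B
        have hTw : T w' = w := by
          ext i
          simp only [T, w', LinearMap.pi_apply, map_sum, ← LinearMap.comp_apply,
            ← LinearMap.rTensor_comp]
          rw [Finset.sum_eq_single i]
          · rw [LinearMap.proj_comp_single_same]; simp
          · intro j _ hj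
            rw [LinearMap.proj_comp_single_ne _ _ _ _ hj.symm]; simp
          · simp
        rw [← hTw, ← ht]
        clear ht
        induction t with
        | zero => rw [map_zero, map_zero]; exact zero_mem _
        | add a b ha hb => rw [map_add, map_add]; exact add_mem ha hb
        | tmul a b =>
          have : T ((u.ker.restrictScalars k).subtype.rTensor B (a ⊗ₜ b)) =
              inr b • (fun i => ι.toRingHom ((a : Fin n → A) i)) := by
            ext i
            simp [T, inr, hι]
          rw [this]
          exact Submodule.smul_mem _ _ (Submodule.subset_span ⟨a, a.2, rfl⟩)
      intro d hd
      induction hd using Submodule.span_induction with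
      | mem d hd =>
        obtain ⟨f, y, hy, rfl⟩ := hd
        have hdet := det_mem_map_minorIdeal ι.toRingHom (u.ker : Set (Fin n → A)) s
          (fun i l => inr (c (f i) l)) (fun j i => ∑ l, δ (y j l) * inr (b i l))
          fun j => hrel (y j) (hy j)
        rw [AlgHom.map_det]
        convert hdet using 2
        ext j i
        have hci : ∀ l, ∑ m, c (f i) m * b m l = if f i = l then 1 else 0 := fun l => by
          rw [← Matrix.mul_apply, hcb, Matrix.one_apply]
        have hci' : ∀ l, ∑ m, inr (c (f i) m) * inr (b m l) = if f i = l then 1 else 0 :=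
          fun l => by
            simp only [← map_mul, ← map_sum, hci]
            split_ifs <;> simp
        simp only [AlgHom.mapMatrix_apply, Matrix.map_apply, Matrix.of_apply, Finset.mul_sum]
        rw [Finset.sum_comm]
        simp only [mul_left_comm _ (δ _), ← Finset.mul_sum, hci']
        simp
      | zero => simp
      | add a b _ _ ha hb => rw [map_add]; exact add_mem ha hb
      | smul r a _ ha => rw [smul_eq_mul, map_mul]; exact Ideal.mul_mem_left _ _ ha
    · change x i ∈ (u.range.restrictScalars k).comap (D.mkQ.restrictScalars k)
      refine (Submodule.span_le.2 ?_) (hx i)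
      rintro _ ⟨j, rfl⟩
      exact ⟨Pi.single j 1, by simp [u, u₀]⟩
  refine Module.Flat.of_forall_isTrivialRelation fun {l f x} hfx => ?_
  choose y hy using fun i => D.mkQ_surjective (x i)
  obtain ⟨W, hW, hyW⟩ := hmain y
  have hxW : ∀ i, x i ∈ W := fun i => hy i ▸ hyW i
  obtain ⟨m, a, z, hxz, ha⟩ := Module.Flat.isTrivialRelation_of_sum_smul_eq_zero (f := f)
    (x := fun i => (⟨x i, hxW i⟩ : W)) (by ext; simpa using hfx)
  exact ⟨m, a, fun j => z j, fun i => by simpa using congrArg W.subtype (hxz i), ha⟩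

theorem Module.FaithfullyFlat.of_injective_of_flat_quotient {A B : Type*} [CommRing A] [CommRing B]
    [Algebra A B] [Module.Flat A B] (hinj : Function.Injective (algebraMap A B))
    [Module.Flat A (B ⧸ (Algebra.linearMap A B).range)] : Module.FaithfullyFlat A B := by
  refine ⟨fun {m} hm htop => hm.ne_top ((Ideal.eq_top_iff_one m).2 ?_)⟩
  have h1 : (1 : B) ∈ m • (Submodule.span A (Set.range (id : B → B))) := by
    rw [Set.range_id, Submodule.span_univ, htop]; trivial
  obtain ⟨f, hf, h1⟩ := (Submodule.mem_ideal_smul_span_iff_exists_sum _ _ _).1 h1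
  let q := (Algebra.linearMap A B).range.mkQ
  have h2 : ∑ i : f.support, f i • q (i : B) = 0 := by
    rw [Finset.sum_coe_sort f.support (fun i => f i • q i)]
    have : q 1 = 0 := (Submodule.Quotient.mk_eq_zero _).2 ⟨1, by simp⟩
    rw [← this, ← h1, Finsupp.sum, map_sum]
    rfl
  obtain ⟨n, c, z, hxz, ha⟩ := Module.Flat.isTrivialRelation_of_sum_smul_eq_zero h2
  choose Z hZ using fun j => Submodule.mkQ_surjective _ (z j)
  have h3 : ∀ i : f.support, ∃ a : A, algebraMap A B a = i - ∑ j, c i j • Z j := fun i => by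
    refine (Submodule.Quotient.mk_eq_zero (Algebra.linearMap A B).range).1 ?_
    rw [← Submodule.mkQ_apply, map_sub, map_sum]
    simp only [map_smul, hZ]
    exact sub_eq_zero.2 (hxz i)
  choose a ha' using h3
  have h5 : ∑ i : f.support, algebraMap A B (f i) * ∑ j, c i j • Z j = 0 := by
    simp only [Algebra.smul_def, Finset.mul_sum, ← mul_assoc, ← map_mul]
    rw [Finset.sum_comm]
    simp only [← Finset.sum_mul, ← map_sum, ha, map_zero, zero_mul, Finset.sum_const_zero]
  have h6 : ∑ i : f.support, algebraMap A B (f i) * (i : B) = 1 := by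
    rw [Finset.sum_coe_sort f.support (fun i => algebraMap A B (f i) * i), ← h1, Finsupp.sum]
    simp only [Algebra.smul_def, id]
  have h4 : algebraMap A B (∑ i : f.support, f i * a i) = algebraMap A B 1 := by
    simp only [map_sum, map_mul, ha', mul_sub, Finset.sum_sub_distrib, h5, h6, sub_zero, map_one]
  rw [← hinj h4]
  exact Ideal.sum_mem _ fun i _ => Ideal.mul_mem_right _ _ (hf i)

theorem BialgHom.faithfullyFlat_of_injective {k A B : Type*} [Field k] [CommRing A] [CommRing B]
    [HopfAlgebra k A] [HopfAlgebra k B] (φ : A →ₐc[k] B) (hφ : Function.Injective φ) :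
    (φ : A →+* B).FaithfullyFlat := by
  let _ : Algebra A B := (φ : A →+* B).toAlgebra
  have : IsScalarTower k A B := IsScalarTower.of_algebraMap_eq fun r => by
    exact (AlgHomClass.commutes φ r).symm
  have hΔ : ∀ a : A, Coalgebra.comul (R := k) (algebraMap A B a) =
      Algebra.TensorProduct.map (IsScalarTower.toAlgHom k A B) (IsScalarTower.toAlgHom k A B)
        (Coalgebra.comul (R := k) a) := by
    intro a
    exact (CoalgHomClass.map_comp_comul_apply φ a).symm
  have hΔ' : ∀ a : A, Coalgebra.comul (R := k) (algebraMap A B a) =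
      Algebra.TensorProduct.map (IsScalarTower.toAlgHom k A B) (AlgHom.id k B)
        (comulBaseChange k A B a) := by
    intro a
    rw [hΔ, comulBaseChange, AlgHom.comp_apply, ← AlgHom.comp_apply,
      ← Algebra.TensorProduct.map_comp]
    rfl
  have h0 : Module.Flat A (B ⧸ (⊥ : Submodule A B)) :=
    Module.Flat.quotient_of_comul_mem (k := k) hφ hΔ' ⊥ fun d hd => by
      rw [(Submodule.mem_bot A).1 hd, map_zero, map_zero]
  have : Module.Flat A B := Module.Flat.of_linearEquiv (Submodule.quotEquivOfEqBot ⊥ rfl).symm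
  have : Module.Flat A (B ⧸ (Algebra.linearMap A B).range) :=
    Module.Flat.quotient_of_comul_mem (k := k) hφ hΔ' _ fun d hd => by
      obtain ⟨a, rfl⟩ := hd
      rw [Algebra.linearMap_apply, hΔ]
      induction Coalgebra.comul (R := k) a with
      | zero => simp
      | add x y hx hy => rw [map_add, map_add, hx, hy, add_zero]
      | tmul x y =>
        have : (Algebra.linearMap A B).range.mkQ (algebraMap A B x) = 0 :=
          (Submodule.Quotient.mk_eq_zero _).2 ⟨x, rfl⟩
        simp only [Algebra.TensorProduct.map_tmul, IsScalarTower.coe_toAlgHom',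
          LinearMap.rTensor_tmul, LinearMap.coe_restrictScalars, this, TensorProduct.zero_tmul]
  exact Module.FaithfullyFlat.of_injective_of_flat_quotient hφ

theorem exists_notMem_smul_eq_zero_of_tmul_one_eq_zero {R M : Type*} [CommRing R] [AddCommGroup M]
    [Module R M] {p : Ideal R} [p.IsPrime] (hM : ∀ r ∈ p, ∀ y : M, r • y = 0) {y : M}
    (hy : y ⊗ₜ[R] (1 : FractionRing (R ⧸ p)) = 0) : ∃ r ∉ p, r • y = 0 := by
  let _ : Module (R ⧸ p) M :=
    Module.IsTorsionBySet.module (I := p) fun y a => hM a a.2 y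
  have : IsScalarTower R (R ⧸ p) M := Module.IsTorsionBySet.isScalarTower _
  have : CompatibleSMul R (R ⧸ p) M (FractionRing (R ⧸ p)) :=
    .of_algebraMap_surjective _ _ Ideal.Quotient.mk_surjective
  have h1 : (1 : FractionRing (R ⧸ p)) ⊗ₜ[R ⧸ p] y = 0 := by
    have h : y ⊗ₜ[R ⧸ p] (1 : FractionRing (R ⧸ p)) = 0 :=
      (TensorProduct.equivOfCompatibleSMul R (R ⧸ p) R M (FractionRing (R ⧸ p))).map_eq_zero_iff.1
        hy
    simpa using congrArg (TensorProduct.comm _ _ _) h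
  obtain ⟨⟨s, hs⟩, h⟩ := (IsLocalizedModule.eq_zero_iff (nonZeroDivisors (R ⧸ p))
    (TensorProduct.mk (R ⧸ p) (FractionRing (R ⧸ p)) M 1)).1 h1
  obtain ⟨r, rfl⟩ := Ideal.Quotient.mk_surjective s
  exact ⟨r, fun hr => nonZeroDivisors.ne_zero hs (Ideal.Quotient.eq_zero_iff_mem.2 hr), h⟩

theorem rTensor_fractionRing_quotient_injective {R M N : Type*} [CommRing R] [AddCommGroup M]
    [Module R M] [AddCommGroup N] [Module R N] {p : Ideal R} [p.IsPrime]
    (hM : ∀ r ∈ p, ∀ y : M, r • y = 0) (hN : ∀ r ∈ p, ∀ y : N, r • y = 0) (f : M →ₗ[R] N)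
    (hf : Function.Injective f) :
    Function.Injective (f.rTensor (FractionRing (R ⧸ p))) := by
  let _ : Module (R ⧸ p) M :=
    Module.IsTorsionBySet.module (I := p) fun y a => hM a a.2 y
  have : IsScalarTower R (R ⧸ p) M := Module.IsTorsionBySet.isScalarTower _
  have : CompatibleSMul R (R ⧸ p) M (FractionRing (R ⧸ p)) :=
    .of_algebraMap_surjective _ _ Ideal.Quotient.mk_surjective
  let _ : Module (R ⧸ p) N :=
    Module.IsTorsionBySet.module (I := p) fun y a => hN a a.2 y
  have : IsScalarTower R (R ⧸ p) N := Module.IsTorsionBySet.isScalarTower _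
  have : CompatibleSMul R (R ⧸ p) N (FractionRing (R ⧸ p)) :=
    .of_algebraMap_surjective _ _ Ideal.Quotient.mk_surjective
  have : Module.Flat (R ⧸ p) (FractionRing (R ⧸ p)) :=
    IsLocalization.flat _ (nonZeroDivisors (R ⧸ p))
  let f' : M →ₗ[R ⧸ p] N := f.extendScalarsOfSurjective Ideal.Quotient.mk_surjective
  let eM := TensorProduct.equivOfCompatibleSMul R (R ⧸ p) R M (FractionRing (R ⧸ p))
  let eN := TensorProduct.equivOfCompatibleSMul R (R ⧸ p) R N (FractionRing (R ⧸ p))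
  have h : ∀ z, f.rTensor (FractionRing (R ⧸ p)) (eM z) =
      eN (f'.rTensor (FractionRing (R ⧸ p)) z) := fun z => by
    induction z with
    | zero => simp
    | add a b ha hb => simp only [map_add, ha, hb]
    | tmul a b => rfl
  intro x y hxy
  obtain ⟨x, rfl⟩ := eM.surjective x
  obtain ⟨y, rfl⟩ := eM.surjective y
  rw [h, h] at hxy
  rw [Module.Flat.rTensor_preserves_injective_linearMap f' hf (eN.injective hxy)]

theorem LinearMap.lTensor_injective_of_lTensor_algebra_injective {A C D Z F : Type*} [CommRing A]
    [CommRing C] [Algebra A C] [AddCommGroup D] [Module A D] [Module C D] [IsScalarTower A C D]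
    [Module.Flat C D] [AddCommGroup Z] [Module A Z] [AddCommGroup F] [Module A F]
    (g : Z →ₗ[A] F) (hg : Function.Injective (g.lTensor C)) :
    Function.Injective (g.lTensor D) := by
  let eZ := TensorProduct.AlgebraTensorModule.cancelBaseChange A C C D Z
  let eF := TensorProduct.AlgebraTensorModule.cancelBaseChange A C C D F
  have h : ∀ z, g.lTensor D (eZ z) = eF ((g.baseChange C).lTensor D z) := fun z => by
    induction z with
    | zero => simp
    | add a b ha hb => simp only [map_add, ha, hb]
    | tmul a b =>
      induction b with
      | zero => simp
      | add b c hb hc => simp only [map_add, TensorProduct.tmul_add, hb, hc]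
      | tmul b c => simp [eZ, eF]
  intro x y hxy
  obtain ⟨x, rfl⟩ := eZ.surjective x
  obtain ⟨y, rfl⟩ := eZ.surjective y
  rw [h, h] at hxy
  rw [Module.Flat.lTensor_preserves_injective_linearMap (M := D) (g.baseChange C) hg
    (eF.injective hxy)]

theorem LinearMap.lTensor_tensorProduct_injective_iff {R A M K Z F : Type*} [CommRing R]
    [CommRing A] [Algebra R A] [AddCommGroup M] [Module R M] [Module A M] [IsScalarTower R A M]
    [AddCommGroup K] [Module R K] [AddCommGroup Z] [Module A Z] [AddCommGroup F] [Module A F]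
    (g : Z →ₗ[A] F) :
    Function.Injective (g.lTensor (M ⊗[R] K)) ↔
      Function.Injective (((g.lTensor M).restrictScalars R).rTensor K) := by
  let eZ := TensorProduct.AlgebraTensorModule.rightComm R A A M Z K
  let eF := TensorProduct.AlgebraTensorModule.rightComm R A A M F K
  have h : g.lTensor (M ⊗[R] K) ∘ eZ = eF ∘ ((g.lTensor M).restrictScalars R).rTensor K := by
    ext z
    dsimp only [Function.comp_apply]
    induction z with
    | zero => simp
    | add a b ha hb => simp only [map_add, ha, hb]
    | tmul a b =>
      induction a with
      | zero => simp
      | add b c hb hc => simp only [map_add, TensorProduct.add_tmul, hb, hc]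
      | tmul b c => simp [eZ, eF]
  rw [← eF.injective.of_comp_iff, ← h, Function.Injective.of_comp_iff' _ eZ.bijective]

theorem smul_tensorProduct_eq_zero {R A M W : Type*} [CommRing R] [CommRing A] [Algebra R A]
    [AddCommGroup M] [Module R M] [Module A M] [IsScalarTower R A M] [AddCommGroup W] [Module A W]
    {I : Ideal R} (h : ∀ r ∈ I, ∀ y : W, algebraMap R A r • y = 0) :
    ∀ r ∈ I, ∀ y : M ⊗[A] W, r • y = 0 := by
  intro r hr y
  rw [algebra_compatible_smul A]
  induction y with
  | zero => simp
  | add a b ha hb => rw [smul_add, ha, hb, add_zero]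
  | tmul a b => rw [← TensorProduct.tmul_smul, h r hr, TensorProduct.tmul_zero]

theorem exists_notMem_smul_eq_zero_of_lTensor_eq_zero {R A B Z F : Type*} [CommRing R]
    [CommRing A] [CommRing B] [Algebra R A] [Algebra R B] [Algebra A B] [IsScalarTower R A B]
    [AddCommGroup Z] [Module A Z] [AddCommGroup F] [Module A F] {p : Ideal R} [p.IsPrime]
    (hflat : (Algebra.TensorProduct.map (IsScalarTower.toAlgHom R A B)
      (AlgHom.id R (FractionRing (R ⧸ p)))).toRingHom.Flat)
    (hZ : ∀ r ∈ p, ∀ y : Z, algebraMap R A r • y = 0)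
    (hF : ∀ r ∈ p, ∀ y : F, algebraMap R A r • y = 0)
    (g : Z →ₗ[A] F) (hg : Function.Injective g) {x : B ⊗[A] Z} (hx : g.lTensor B x = 0) :
    ∃ r ∉ p, algebraMap R A r • x = 0 := by
  let _ := (Algebra.TensorProduct.map (IsScalarTower.toAlgHom R A B)
      (AlgHom.id R (FractionRing (R ⧸ p)))).toRingHom.toAlgebra
  have : Module.Flat (A ⊗[R] FractionRing (R ⧸ p)) (B ⊗[R] FractionRing (R ⧸ p)) := hflat
  have : IsScalarTower A (A ⊗[R] FractionRing (R ⧸ p)) (B ⊗[R] FractionRing (R ⧸ p)) :=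
    ⟨fun a c x => by
      rw [RingHom.smul_toAlgebra', RingHom.smul_toAlgebra', ← smul_mul_assoc]
      congr 1
      induction c with
      | zero => simp
      | add x y hx hy => rw [smul_add, map_add, hx, hy, map_add, smul_add]
      | tmul x y => simp [TensorProduct.smul_tmul', Algebra.smul_def]⟩
  have h1 : Function.Injective (g.lTensor (A ⊗[R] FractionRing (R ⧸ p))) := by
    rw [LinearMap.lTensor_tensorProduct_injective_iff]
    exact rTensor_fractionRing_quotient_injective (smul_tensorProduct_eq_zero hZ)
      (smul_tensorProduct_eq_zero hF) _
      (Module.Flat.lTensor_preserves_injective_linearMap g hg)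
  have h2 := (LinearMap.lTensor_tensorProduct_injective_iff (R := R) g).1
    (LinearMap.lTensor_injective_of_lTensor_algebra_injective
      (D := B ⊗[R] FractionRing (R ⧸ p)) g h1)
  obtain ⟨r, hr, h⟩ := exists_notMem_smul_eq_zero_of_tmul_one_eq_zero
    (smul_tensorProduct_eq_zero hZ) (y := x)
    (h2 (by simp [hx]))
  exact ⟨r, hr, by rw [← algebra_compatible_smul, h]⟩

/-- `Tor₁(N' / N, B)` vanishes whenever `N' / N` is killed by the ideal `I` of `R`. -/
def LTensorInjectiveOfSMulMemRange {R : Type u} (A B : Type u) [CommRing R] [CommRing A]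
    [CommRing B] [Algebra R A] [Algebra A B] (I : Ideal R) : Prop :=
  ∀ (N N' : Type u) [AddCommGroup N] [AddCommGroup N'] [Module A N] [Module A N']
    (f : N →ₗ[A] N'), Function.Injective f →
    (∀ r ∈ I, ∀ y : N', algebraMap R A r • y ∈ f.range) → Function.Injective (f.lTensor B)

theorem LTensorInjectiveOfSMulMemRange.top {R : Type u} (A B : Type u) [CommRing R] [CommRing A]
    [CommRing B] [Algebra R A] [Algebra A B] :
    LTensorInjectiveOfSMulMemRange A B (⊤ : Ideal R) := by
  intro N N' _ _ _ _ f hf h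
  have hs : Function.Surjective f := fun y => by simpa using h 1 trivial y
  exact (LinearEquiv.lTensor B (LinearEquiv.ofBijective f ⟨hf, hs⟩)).injective

theorem LTensorInjectiveOfSMulMemRange.of_mul_mem {R A B : Type u} [CommRing R] [CommRing A]
    [CommRing B] [Algebra R A] [Algebra A B] {I : Ideal R} {a b : R} (hab : a * b ∈ I)
    (ha : LTensorInjectiveOfSMulMemRange A B (I ⊔ Ideal.span {a}))
    (hb : LTensorInjectiveOfSMulMemRange A B (I ⊔ Ideal.span {b})) :
    LTensorInjectiveOfSMulMemRange A B I := by
  intro N N' _ _ _ _ f hf h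
  let N₁ : Submodule A N' := f.range ⊔ (LinearMap.lsmul A N' (algebraMap R A a)).range
  let f₁ : N →ₗ[A] N₁ := f.codRestrict N₁ fun x => Submodule.mem_sup_left ⟨x, rfl⟩
  have hf₁ : Function.Injective (f₁.lTensor B) := by
    refine hb N N₁ f₁ (fun x y hxy => hf (congrArg Subtype.val hxy)) fun r hr ⟨y, hy⟩ => ?_
    suffices algebraMap R A r • y ∈ f.range by
      obtain ⟨x, hx⟩ := this
      exact ⟨x, Subtype.ext hx⟩
    obtain ⟨i, hi, c, hc, rfl⟩ := Submodule.mem_sup.1 hr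
    obtain ⟨c, rfl⟩ := Ideal.mem_span_singleton'.1 hc
    obtain ⟨_, ⟨x, rfl⟩, _, ⟨z, rfl⟩, rfl⟩ := Submodule.mem_sup.1 hy
    rw [map_add, add_smul]
    refine add_mem (h i hi _) ?_
    rw [smul_add]
    refine add_mem (Submodule.smul_mem _ _ ⟨x, rfl⟩) ?_
    rw [LinearMap.lsmul_apply, smul_smul, ← map_mul, mul_assoc, mul_comm b]
    exact h _ (Ideal.mul_mem_left _ _ hab) z
  have hf₂ : Function.Injective (N₁.subtype.lTensor B) := by
    refine ha N₁ N' N₁.subtype N₁.injective_subtype fun r hr y => ?_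
    rw [Submodule.range_subtype]
    obtain ⟨i, hi, c, hc, rfl⟩ := Submodule.mem_sup.1 hr
    obtain ⟨c, rfl⟩ := Ideal.mem_span_singleton'.1 hc
    rw [map_add, add_smul, map_mul, mul_smul]
    exact add_mem (Submodule.mem_sup_left (h i hi y))
      (Submodule.smul_mem _ _ (Submodule.mem_sup_right ⟨y, rfl⟩))
  have : f = N₁.subtype ∘ₗ f₁ := rfl
  rw [this, LinearMap.lTensor_comp]
  exact hf₂.comp hf₁

theorem LinearMap.lTensor_injective_of_comap {A B N N' F : Type*} [CommRing A] [AddCommGroup B]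
    [Module A B] [AddCommGroup N] [AddCommGroup N'] [AddCommGroup F] [Module A N] [Module A N']
    [Module A F] (f : N →ₗ[A] N') (hf : Function.Injective f) (π : F →ₗ[A] N')
    (hπ : Function.Surjective π)
    (h : Function.Injective ((f.range.comap π).subtype.lTensor B)) :
    Function.Injective (f.lTensor B) := by
  let e := LinearEquiv.ofInjective f hf
  let π' : f.range.comap π →ₗ[A] f.range := π.restrict fun _ hx => hx
  let ρ : f.range.comap π →ₗ[A] N := e.symm ∘ₗ π'
  have hfρ : f ∘ₗ ρ = π ∘ₗ (f.range.comap π).subtype := by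
    ext x
    exact congrArg Subtype.val (e.apply_symm_apply (π' x))
  have hρ : Function.Surjective ρ := fun y => by
    obtain ⟨x, hx⟩ := hπ (f y)
    exact ⟨⟨x, y, hx.symm⟩, hf ((LinearMap.congr_fun hfρ _).trans hx)⟩
  let κ : π.ker →ₗ[A] f.range.comap π := Submodule.inclusion fun x hx => ⟨0, by simpa using hx.symm⟩
  have hκ : ρ ∘ₗ κ = 0 := by
    ext x
    exact hf ((LinearMap.congr_fun hfρ _).trans ((LinearMap.mem_ker.1 x.2).trans (map_zero f).symm))
  rw [injective_iff_map_eq_zero]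
  intro x hx
  obtain ⟨z, rfl⟩ := LinearMap.lTensor_surjective B hρ x
  rw [← LinearMap.comp_apply, ← LinearMap.lTensor_comp, hfρ, LinearMap.lTensor_comp,
    LinearMap.comp_apply] at hx
  obtain ⟨w, hw⟩ := (lTensor_exact B (LinearMap.exact_subtype_ker_map π) hπ _).1 hx
  have : κ.lTensor B w = z := h (by
    rw [← hw, ← LinearMap.comp_apply, ← LinearMap.lTensor_comp]; rfl)
  rw [← this, ← LinearMap.comp_apply, ← LinearMap.lTensor_comp, hκ, LinearMap.lTensor_zero,
    LinearMap.zero_apply]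

theorem LTensorInjectiveOfSMulMemRange.subtype {R A B F : Type u} [CommRing R] [CommRing A]
    [CommRing B] [Algebra R A] [Algebra R B] [Algebra A B] [IsScalarTower R A B]
    [Module.Flat R A] [Module.Flat R B] [AddCommGroup F] [Module R F] [Module A F]
    [IsScalarTower R A F] [Module.Flat A F] {p : Ideal R} [p.IsPrime]
    (hflat : (Algebra.TensorProduct.map (IsScalarTower.toAlgHom R A B)
      (AlgHom.id R (FractionRing (R ⧸ p)))).toRingHom.Flat)
    (h : ∀ I > p, LTensorInjectiveOfSMulMemRange A B I) (Z : Submodule A F)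
    (hZ : ∀ r ∈ p, ∀ y : F, algebraMap R A r • y ∈ Z) :
    Function.Injective (Z.subtype.lTensor B) := by
  have : Module.Flat R F := Module.Flat.trans R A F
  have : Module.Flat R (B ⊗[A] F) := Module.Flat.trans R B _
  let g : F →ₗ[A] F ⊗[R] (R ⧸ p) :=
    TensorProduct.AlgebraTensorModule.map LinearMap.id (Submodule.mkQ p) ∘ₗ
      (TensorProduct.AlgebraTensorModule.rid R A F).symm
  let j : F ⊗[R] p →ₗ[A] F := (TensorProduct.AlgebraTensorModule.rid R A F).toLinearMap ∘ₗ
    TensorProduct.AlgebraTensorModule.map LinearMap.id (Submodule.subtype p)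
  have hj_tmul : ∀ x (r : p), j (x ⊗ₜ r) = (r : R) • x := fun x r => by simp [j]
  have hjg : Function.Exact j g := by
    intro y
    obtain ⟨y, rfl⟩ := (TensorProduct.AlgebraTensorModule.rid R A F).surjective y
    have := lTensor_exact F (LinearMap.exact_subtype_mkQ p) (Submodule.mkQ_surjective p) y
    simp only [g, LinearMap.comp_apply, LinearEquiv.coe_coe, LinearEquiv.symm_apply_apply]
    refine this.trans ⟨?_, ?_⟩
    · rintro ⟨x, rfl⟩
      exact ⟨x, rfl⟩
    · rintro ⟨x, hx⟩
      exact ⟨x, (TensorProduct.AlgebraTensorModule.rid R A F).injective hx⟩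
  have hjZ : ∀ x, j x ∈ Z := fun x => by
    induction x with
    | zero => simp
    | add a b ha hb => rw [map_add]; exact add_mem ha hb
    | tmul a b => rw [hj_tmul, ← algebraMap_smul A]; exact hZ _ b.2 _
  let jZ : F ⊗[R] p →ₗ[A] Z := j.codRestrict Z hjZ
  have hexZ : Function.Exact jZ (g.submoduleMap Z) := by
    intro y
    have : g.submoduleMap Z y = 0 ↔ g y = 0 := by
      rw [Subtype.ext_iff]; rfl
    rw [this, hjg]
    exact ⟨fun ⟨x, hx⟩ => ⟨x, Subtype.ext hx⟩, fun ⟨x, hx⟩ => ⟨x, congrArg Subtype.val hx⟩⟩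
  -- Multiplication by elements outside `p` is injective on `F / pF`.
  have hreg : ∀ r ∉ p, ∀ y : F ⊗[R] (R ⧸ p), r • y = 0 → y = 0 := by
    intro r hr y hy
    have h1 : Function.Injective (LinearMap.lsmul R (R ⧸ p) r) := by
      rw [injective_iff_map_eq_zero]
      intro z hz
      obtain ⟨z, rfl⟩ := Ideal.Quotient.mk_surjective z
      have : r * z ∈ p := Ideal.Quotient.eq_zero_iff_mem.1 hz
      exact Ideal.Quotient.eq_zero_iff_mem.2
        ((Ideal.IsPrime.mem_or_mem ‹_› this).resolve_left hr)
    apply Module.Flat.lTensor_preserves_injective_linearMap (M := F) _ h1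
    rw [map_zero, ← hy]
    clear hy
    induction y with
    | zero => simp
    | add a b ha hb => rw [map_add, ha, hb, smul_add]
    | tmul a b => simp
  have hkill : ∀ r ∈ p, ∀ y : F ⊗[R] (R ⧸ p), algebraMap R A r • y = 0 := by
    intro r hr y
    rw [algebraMap_smul]
    induction y with
    | zero => simp
    | add a b ha hb => rw [smul_add, ha, hb, add_zero]
    | tmul a b =>
      obtain ⟨b, rfl⟩ := Ideal.Quotient.mk_surjective b
      have : r • Ideal.Quotient.mk p b = 0 :=
        (Submodule.Quotient.mk_eq_zero p).2 (p.mul_mem_right b hr)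
      rw [← TensorProduct.tmul_smul, this, TensorProduct.tmul_zero]
  have hkill' : ∀ r ∈ p, ∀ y : Z.map g, algebraMap R A r • y = 0 := fun r hr y =>
    Subtype.ext (hkill r hr y)
  have hbar : Function.Injective ((Z.map g).subtype.lTensor B) := by
    rw [injective_iff_map_eq_zero]
    intro x hx
    obtain ⟨r, hr, hrx⟩ := exists_notMem_smul_eq_zero_of_lTensor_eq_zero hflat hkill' hkill
      (Z.map g).subtype (Z.map g).injective_subtype hx
    let μ := LinearMap.lsmul A (Z.map g) (algebraMap R A r)
    have hμ : Function.Injective (μ.lTensor B) := by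
      refine h (p ⊔ Ideal.span {r}) ?_ _ _ μ ?_ ?_
      · refine lt_of_le_of_ne le_sup_left fun h => hr ?_
        rw [h]
        exact Ideal.mem_sup_right (Ideal.mem_span_singleton_self r)
      · rw [injective_iff_map_eq_zero]
        intro y hy
        refine Subtype.ext (hreg r hr y ?_)
        rw [← algebraMap_smul A]
        exact congrArg Subtype.val hy
      · intro s hs y
        obtain ⟨i, hi, c, hc, rfl⟩ := Submodule.mem_sup.1 hs
        obtain ⟨c, rfl⟩ := Ideal.mem_span_singleton'.1 hc
        rw [map_add, add_smul, hkill' i hi, zero_add]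
        exact ⟨algebraMap R A c • y, by
          rw [LinearMap.lsmul_apply, smul_smul, map_mul, mul_comm]⟩
    apply hμ
    rw [map_zero, ← hrx]
    clear hx hrx
    induction x with
    | zero => simp
    | add a b ha hb => rw [map_add, ha, hb, smul_add]
    | tmul a b => simp [μ]
  have hj : Function.Injective (j.lTensor B) := by
    let e := TensorProduct.AlgebraTensorModule.assoc R A A B F p
    have h1 : Function.Injective ((TensorProduct.rid R (B ⊗[A] F)) ∘
        (Submodule.subtype p).lTensor (B ⊗[A] F)) :=
      (TensorProduct.rid R (B ⊗[A] F)).injective.comp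
        (Module.Flat.lTensor_preserves_injective_linearMap _ p.injective_subtype)
    have h2 : (TensorProduct.rid R (B ⊗[A] F)) ∘ (Submodule.subtype p).lTensor (B ⊗[A] F) =
        j.lTensor B ∘ e := by
      funext x
      dsimp only [Function.comp_apply]
      induction x with
      | zero => simp
      | add a b ha hb => simp only [map_add, ha, hb]
      | tmul a b =>
        induction a with
        | zero => simp
        | add c d hc hd => simp only [map_add, TensorProduct.add_tmul, hc, hd]
        | tmul c d => simp [e, hj_tmul]
    rw [h2] at h1
    exact (Function.Injective.of_comp_iff' _ e.bijective).1 h1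
  rw [injective_iff_map_eq_zero]
  intro x hx
  have h1 : (g.submoduleMap Z).lTensor B x = 0 := by
    apply hbar
    rw [map_zero, ← LinearMap.comp_apply, ← LinearMap.lTensor_comp]
    have : (Z.map g).subtype ∘ₗ g.submoduleMap Z = g ∘ₗ Z.subtype := rfl
    rw [this, LinearMap.lTensor_comp, LinearMap.comp_apply, hx, map_zero]
  obtain ⟨w, rfl⟩ := (lTensor_exact B hexZ (g.submoduleMap_surjective Z) x).1 h1
  have : w = 0 := hj (by
    rw [map_zero, ← hx, ← LinearMap.comp_apply, ← LinearMap.lTensor_comp]; rfl)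
  rw [this, map_zero]

theorem LTensorInjectiveOfSMulMemRange.of_isPrime {R A B : Type u} [CommRing R] [CommRing A]
    [CommRing B] [Algebra R A] [Algebra R B] [Algebra A B] [IsScalarTower R A B]
    [Module.Flat R A] [Module.Flat R B] {p : Ideal R} [p.IsPrime]
    (hflat : (Algebra.TensorProduct.map (IsScalarTower.toAlgHom R A B)
      (AlgHom.id R (FractionRing (R ⧸ p)))).toRingHom.Flat)
    (h : ∀ I > p, LTensorInjectiveOfSMulMemRange A B I) :
    LTensorInjectiveOfSMulMemRange A B p := by
  intro N N' _ _ _ _ f hf hN'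
  let π : (N' →₀ A) →ₗ[A] N' := Finsupp.linearCombination A id
  refine f.lTensor_injective_of_comap hf π (Finsupp.linearCombination_id_surjective A N') ?_
  refine LTensorInjectiveOfSMulMemRange.subtype hflat h _ fun r hr y => ?_
  rw [Submodule.mem_comap, map_smul]
  exact hN' r hr _

theorem Module.Flat.of_forall_flat_fractionRing_quotient {R A B : Type u} [CommRing R]
    [IsNoetherianRing R] [CommRing A]
    [CommRing B] [Algebra R A] [Algebra R B] [Algebra A B] [IsScalarTower R A B]
    [Module.Flat R A] [Module.Flat R B]
    (hflat : ∀ (p : Ideal R) [p.IsPrime], (Algebra.TensorProduct.map (IsScalarTower.toAlgHom R A B)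
      (AlgHom.id R (FractionRing (R ⧸ p)))).toRingHom.Flat) : Module.Flat A B := by
  have h : ∀ I : Ideal R, LTensorInjectiveOfSMulMemRange A B I := by
    refine IsNoetherian.induction (P := fun I : Ideal R => _) fun (I : Ideal R) ih => ?_
    rcases eq_or_ne I ⊤ with rfl | hI
    · exact .top A B
    by_cases hp : I.IsPrime
    · exact .of_isPrime (hflat I) ih
    obtain ⟨a, ha, b, hb, hab⟩ := (Ideal.not_isPrime_iff.1 hp).resolve_left hI
    have hlt : ∀ c ∉ I, I < I ⊔ Ideal.span {c} := fun c hc =>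
      lt_of_le_of_ne le_sup_left fun h => hc
        (h ▸ Ideal.mem_sup_right (Ideal.mem_span_singleton_self c))
    exact .of_mul_mem hab (ih _ (hlt a ha)) (ih _ (hlt b hb))
  rw [Module.Flat.iff_lTensor_preserves_injective_linearMap]
  intro N N' _ _ _ _ f hf
  refine h ⊥ N N' f hf fun r hr y => ?_
  rw [(Submodule.mem_bot R).1 hr, map_zero, zero_smul]
  exact zero_mem _

theorem RingHom.FaithfullyFlat.map_ne_top {A B : Type*} [CommRing A] [CommRing B] {f : A →+* B}
    (hf : f.FaithfullyFlat) {I : Ideal A} (hI : I ≠ ⊤) : I.map f ≠ ⊤ := by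
  let _ := f.toAlgebra
  have : Module.FaithfullyFlat A B := hf
  intro h
  refine hI (((Module.FaithfullyFlat.iff_flat_and_ideal_smul_eq_top A B).1 this).2 I ?_)
  rw [Ideal.smul_top_eq_map]
  exact congrArg (Submodule.restrictScalars A) h

theorem Module.FaithfullyFlat.of_forall_fractionRing_quotient {R A B : Type u} [CommRing R]
    [IsNoetherianRing R] [CommRing A] [CommRing B] [Algebra R A] [Algebra R B] [Algebra A B]
    [IsScalarTower R A B] [Module.Flat R A] [Module.Flat R B]
    (h : ∀ (p : Ideal R) [p.IsPrime], (Algebra.TensorProduct.map (IsScalarTower.toAlgHom R A B)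
      (AlgHom.id R (FractionRing (R ⧸ p)))).toRingHom.FaithfullyFlat) :
    Module.FaithfullyFlat A B := by
  have : Module.Flat A B :=
    Module.Flat.of_forall_flat_fractionRing_quotient fun p _ => (h p).flat
  refine ⟨fun m hm htop => ?_⟩
  let p := m.comap (algebraMap R A)
  let ι : A →+* A ⊗[R] FractionRing (R ⧸ p) := Algebra.TensorProduct.includeLeftRingHom
  have hι : m.map ι ≠ ⊤ := by
    intro hmι
    let χ := Algebra.TensorProduct.map (Ideal.Quotient.mkₐ R m)
      (AlgHom.id R (FractionRing (R ⧸ p)))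
    have h1 : m.map ι ≤ RingHom.ker χ := by
      rw [Ideal.map_le_iff_le_comap]
      intro a ha
      simp [RingHom.mem_ker, χ, ι, Ideal.Quotient.eq_zero_iff_mem.2 ha]
    have h2 : χ 1 = 0 := h1 (hmι ▸ Submodule.mem_top)
    rw [map_one, Algebra.TensorProduct.one_def] at h2
    obtain ⟨r, hr, h3⟩ := exists_notMem_smul_eq_zero_of_tmul_one_eq_zero (p := p)
      (fun r hr y => by
        rw [Algebra.smul_def, IsScalarTower.algebraMap_apply R A (A ⧸ m),
          Ideal.Quotient.algebraMap_eq, Ideal.Quotient.eq_zero_iff_mem (I := m).2 hr, zero_mul]) h2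
    rw [Algebra.smul_def, mul_one] at h3
    exact hr (Ideal.Quotient.eq_zero_iff_mem (I := m).1 h3)
  refine (h p).map_ne_top hι ?_
  have hm : m.map (algebraMap A B) = ⊤ := by
    rw [Ideal.smul_top_eq_map] at htop
    exact (Submodule.restrictScalars_eq_top_iff A B B).1 htop
  let ι' : B →+* B ⊗[R] FractionRing (R ⧸ p) := Algebra.TensorProduct.includeLeftRingHom
  have hcomp : (Algebra.TensorProduct.map (IsScalarTower.toAlgHom R A B)
      (AlgHom.id R (FractionRing (R ⧸ p)))).toRingHom.comp ι = ι'.comp (algebraMap A B) := by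
    ext a
    simp [ι, ι']
  rw [Ideal.map_map, hcomp, ← Ideal.map_map, hm, Ideal.map_top]

theorem Module.FaithfullyFlat.rTensor_injective {R A B E : Type*} [CommRing R] [CommRing A]
    [CommRing B] [Algebra R A] [Algebra R B] [Algebra A B] [IsScalarTower R A B]
    [Module.FaithfullyFlat A B] [AddCommGroup E] [Module R E] :
    Function.Injective ((IsScalarTower.toAlgHom R A B).toLinearMap.rTensor E) := by
  let e := TensorProduct.AlgebraTensorModule.cancelBaseChange R A B B E
  have h : ⇑((IsScalarTower.toAlgHom R A B).toLinearMap.rTensor E) =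
      e ∘ TensorProduct.mk A B (A ⊗[R] E) 1 := by
    funext x
    dsimp only [Function.comp_apply]
    induction x with
    | zero => simp
    | add a b ha hb => simp only [map_add, ha, hb]
    | tmul a b => simp [e, Algebra.smul_def]
  rw [h]
  exact e.injective.comp (Module.FaithfullyFlat.tensorProduct_mk_injective _)

theorem BialgHom.faithfullyFlat_map_id_of_rTensor_injective {R A B K : Type u} [CommRing R]
    [CommRing A] [CommRing B] [HopfAlgebra R A] [HopfAlgebra R B] [Field K] [Algebra R K]
    (φ : A →ₐc[R] B) (h : Function.Injective ((φ : A →ₗ[R] B).rTensor K)) :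
    (Algebra.TensorProduct.map (φ : A →ₐ[R] B) (AlgHom.id R K)).toRingHom.FaithfullyFlat := by
  let ψ : K ⊗[R] A →ₐc[K] K ⊗[R] B := Bialgebra.TensorProduct.map (BialgHom.id K K) φ
  let eA := Algebra.TensorProduct.comm R A K
  let eB := Algebra.TensorProduct.comm R K B
  have hψ : ∀ x, Algebra.TensorProduct.map (φ : A →ₐ[R] B) (AlgHom.id R K) x = eB (ψ (eA x)) := by
    intro x
    induction x with
    | zero => simp
    | add a b ha hb => simp only [map_add, ha, hb]
    | tmul a b => simp [eA, eB, ψ]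
  have hψ' : ∀ x, (φ : A →ₗ[R] B).rTensor K x = eB (ψ (eA x)) := fun x => hψ x
  have hinj : Function.Injective ψ := by
    rw [← Function.Injective.of_comp_iff' _ eA.bijective, ← eB.injective.of_comp_iff]
    intro x y hxy
    exact h ((hψ' x).trans (hxy.trans (hψ' y).symm))
  have : (Algebra.TensorProduct.map (φ : A →ₐ[R] B) (AlgHom.id R K)).toRingHom =
      ((eB : K ⊗[R] B →+* B ⊗[R] K).comp (ψ : K ⊗[R] A →+* K ⊗[R] B)).comp
        (eA : A ⊗[R] K →+* K ⊗[R] A) := RingHom.ext hψ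
  have hA : (eA : A ⊗[R] K →+* K ⊗[R] A).FaithfullyFlat := .of_bijective eA.bijective
  have hB : (eB : K ⊗[R] B →+* B ⊗[R] K).FaithfullyFlat := .of_bijective eB.bijective
  rw [this]
  exact RingHom.FaithfullyFlat.stableUnderComposition _ _ hA
    (RingHom.FaithfullyFlat.stableUnderComposition _ _ (ψ.faithfullyFlat_of_injective hinj) hB)

/-!
Theorem 7.1 (faithful flatness of pure Hopf subalgebras), in Hopf-algebraic terms: let `R` be
a commutative noetherian ring, `A` and `B` commutative Hopf algebras over `R` which are flat
as `R`-modules (i.e. coordinate rings of flat affine group schemes over `R`), and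
`φ : A →ₐc[R] B` a homomorphism of `R`-bialgebras.  Then the following are equivalent:
(1) `B` is faithfully flat as an `A`-module via `φ`;
(2) for every prime `p` of `R`, `B ⊗_R k(p)` is faithfully flat over `A ⊗_R k(p)` via
`φ ⊗_R k(p)` (where `k(p) = Frac(R ⧸ p)`);
(3) `φ` is a pure map of `R`-modules.
-/

set_option synthInstance.maxHeartbeats 1000000
set_option maxHeartbeats 2000000

open TensorProduct

theorem hopf_hom_faithfully_flat_iff_pure
    (R A B : Type) [CommRing R] [IsNoetherianRing R] [CommRing A] [CommRing B]
    [HopfAlgebra R A] [HopfAlgebra R B]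
    [Module.Flat R A] [Module.Flat R B]
    (φ : A →ₐc[R] B) :
    ((@Module.FaithfullyFlat A B _ _ (Module.compHom B (φ : A →+* B))) ↔
      (∀ (p : Ideal R) [p.IsPrime],
        @Module.FaithfullyFlat (A ⊗[R] FractionRing (R ⧸ p)) (B ⊗[R] FractionRing (R ⧸ p)) _ _
          (Module.compHom (B ⊗[R] FractionRing (R ⧸ p))
            (Algebra.TensorProduct.map (φ : A →ₐ[R] B)
              (AlgHom.id R (FractionRing (R ⧸ p)))).toRingHom))) ∧
    ((@Module.FaithfullyFlat A B _ _ (Module.compHom B (φ : A →+* B))) ↔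
      (∀ (E : Type) [AddCommGroup E] [Module R E],
        Function.Injective (LinearMap.rTensor E (φ : A →ₗ[R] B)))) := by
  change ((φ : A →+* B).FaithfullyFlat ↔ ∀ (p : Ideal R) [p.IsPrime],
      (Algebra.TensorProduct.map (φ : A →ₐ[R] B)
        (AlgHom.id R (FractionRing (R ⧸ p)))).toRingHom.FaithfullyFlat) ∧
    ((φ : A →+* B).FaithfullyFlat ↔ _)
  let _ : Algebra A B := (φ : A →+* B).toAlgebra
  have : IsScalarTower R A B := IsScalarTower.of_algebraMap_eq fun r =>
    (AlgHomClass.commutes φ r).symm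
  have h₁₃ : (φ : A →+* B).FaithfullyFlat → ∀ (E : Type) [AddCommGroup E] [Module R E],
      Function.Injective (LinearMap.rTensor E (φ : A →ₗ[R] B)) := fun h E _ _ =>
    have : Module.FaithfullyFlat A B := h
    Module.FaithfullyFlat.rTensor_injective
  have h₃₂ : (∀ (E : Type) [AddCommGroup E] [Module R E],
      Function.Injective (LinearMap.rTensor E (φ : A →ₗ[R] B))) → ∀ (p : Ideal R) [p.IsPrime],
      (Algebra.TensorProduct.map (φ : A →ₐ[R] B)
        (AlgHom.id R (FractionRing (R ⧸ p)))).toRingHom.FaithfullyFlat := fun h p _ =>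
    φ.faithfullyFlat_map_id_of_rTensor_injective (h _)
  have h₂₁ : (∀ (p : Ideal R) [p.IsPrime], (Algebra.TensorProduct.map (φ : A →ₐ[R] B)
      (AlgHom.id R (FractionRing (R ⧸ p)))).toRingHom.FaithfullyFlat) →
      (φ : A →+* B).FaithfullyFlat :=
    Module.FaithfullyFlat.of_forall_fractionRing_quotient
  exact ⟨⟨fun h => h₃₂ (h₁₃ h), h₂₁⟩, ⟨h₁₃, fun h => h₂₁ (h₃₂ h)⟩⟩
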